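/- arXiv:1807.04707 — 4 statements merged into one kernel-verified Lean document; each statement's English description precedes it below -/
import Mathlib

section
/- For every m > 0, the closed real-linear span in ℋ_m of the set of mass-shell restrictions { p ↦ f̂⁺(p) : f ∈ C_c^∞(ℝ², ℝ) with supp f ⊆ V₋ } is all of ℋ_m; that is, every vector of the complex Hilbert space ℋ_m is a limit of real-linear combinations of such mass-shell restrictions. (The same holds with V₋ replaced by the forward cone V₊ = {(a₀,a₁) ∈ ℝ² : a₀ > |a₁|}.) -/
open MeasureTheory

/-- The measure on `ℝ` with density `1/(2ω_m(p))`, `ω_m(p) = √(m² + p²)`, with respect to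
Lebesgue measure; the one-particle space is `ℋ_m = L²(ℝ, dp/(2ω_m(p)))`. -/
noncomputable def massShellMeasure (m : ℝ) : Measure ℝ :=
  volume.withDensity (fun p => ENNReal.ofReal (1 / (2 * Real.sqrt (m ^ 2 + p ^ 2))))

/-- The mass-shell restriction of a test function `f` on `ℝ²`:
`f̂⁺(p) = (1/2π) ∫ f(a₀,a₁) e^{−i(a₀ ω_m(p) − a₁ p)} da₀ da₁`. -/
noncomputable def massShellRestriction (m : ℝ) (f : ℝ × ℝ → ℝ) (p : ℝ) : ℂ :=
  (1 / (2 * Real.pi)) *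
    ∫ a : ℝ × ℝ, (f a : ℂ) *
      Complex.exp (-Complex.I * ((a.1 : ℂ) * (Real.sqrt (m ^ 2 + p ^ 2) : ℝ) - (a.2 : ℂ) * p))

/-- The open backward light cone `V₋ = {(a₀,a₁) : a₀ < −|a₁|}`. -/
def backwardCone : Set (ℝ × ℝ) := {a : ℝ × ℝ | a.1 < -|a.2|}

/-- The open forward light cone `V₊ = {(a₀,a₁) : a₀ > |a₁|}`. -/
def forwardCone : Set (ℝ × ℝ) := {a : ℝ × ℝ | |a.2| < a.1}

/-- The elements of `ℋ_m` given by mass-shell restrictions of smooth compactly supported real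
test functions supported in a region `V ⊆ ℝ²`. -/
def localOneParticleVectors (m : ℝ) (V : Set (ℝ × ℝ)) : Set (Lp ℂ 2 (massShellMeasure m)) :=
  {g : Lp ℂ 2 (massShellMeasure m) | ∃ f : ℝ × ℝ → ℝ,
    ContDiff ℝ (⊤ : ℕ∞) f ∧ HasCompactSupport f ∧ tsupport f ⊆ V ∧
    (g : ℝ → ℂ) =ᵐ[massShellMeasure m] massShellRestriction m f}

section

open Set Complex Filter Topology

theorem integrable_laplace_phase {k : ℝ → ℂ} (hk : Integrable k) {α : ℝ → ℝ}
    (hα : Measurable α) {l : ℂ} (hl : 0 < l.re) :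
    Integrable (Function.uncurry fun (v p : ℝ) =>
      exp (-l * v) * (k p * exp (-I * (v * α p)))) ((volume.restrict (Ioi 0)).prod volume) := by
  have hint : Integrable (fun v : ℝ => exp (-l * v)) (volume.restrict (Ioi 0)) :=
    integrableOn_exp_mul_complex_Ioi (by simpa using hl) 0
  refine ((hint.mul_prod hk).mul_bdd (c := 1)
    (g := fun x : ℝ × ℝ => exp (-I * (x.1 * α x.2))) ?_ ?_).congr ?_
  · exact Measurable.aestronglyMeasurable (by fun_prop)
  · refine Filter.Eventually.of_forall fun x => ?_
    rw [norm_exp]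
    simp
  · exact Filter.Eventually.of_forall fun x => by simp [Function.uncurry, mul_assoc]

theorem integral_laplace_phase {k : ℝ → ℂ} (hk : Integrable k) {α : ℝ → ℝ}
    (hα : Measurable α) {l : ℂ} (hl : 0 < l.re) :
    ∫ v in Ioi (0 : ℝ), (∫ p, exp (-l * v) * (k p * exp (-I * (v * α p)))) =
      ∫ p, k p * (l + I * α p)⁻¹ := by
  rw [integral_integral_swap (integrable_laplace_phase hk hα hl)]
  refine integral_congr_ae (Filter.Eventually.of_forall fun p => ?_)
  have h1 : ∀ v : ℝ, exp (-l * v) * (k p * exp (-I * (v * α p))) =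
      k p * exp (-(l + I * α p) * v) := fun v => by
    rw [mul_left_comm, ← exp_add]; ring_nf
  simp_rw [h1, integral_const_mul]
  rw [integral_exp_mul_complex_Ioi (by simpa using hl), ofReal_zero, mul_zero, exp_zero,
    neg_div_neg_eq, one_div]

theorem integrable_mul_inv_add {k : ℝ → ℂ} (hk : Integrable k) {α : ℝ → ℝ}
    (hα : Measurable α) {l : ℂ} (hl : 0 < l.re) :
    Integrable fun p => k p * (l + I * α p)⁻¹ := by
  refine hk.mul_bdd (c := l.re⁻¹) (Measurable.aestronglyMeasurable (by fun_prop)) ?_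
  refine Filter.Eventually.of_forall fun p => ?_
  rw [norm_inv]
  refine inv_anti₀ hl ?_
  simpa using re_le_norm (l + I * α p)

theorem integrable_mul_exp_phase {k : ℝ → ℂ} (hk : Integrable k) {α : ℝ → ℝ}
    (hα : Measurable α) (v : ℝ) :
    Integrable fun p => k p * exp (-I * (v * α p)) := by
  refine hk.mul_bdd (c := 1) (Measurable.aestronglyMeasurable (by fun_prop)) ?_
  refine Filter.Eventually.of_forall fun p => ?_
  rw [norm_exp]
  simp

theorem integral_resolvent_pair_eq_zero {k₁ k₂ : ℝ → ℂ} (hk₁ : Integrable k₁)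
    (hk₂ : Integrable k₂) {α₁ α₂ : ℝ → ℝ} (hα₁ : Measurable α₁) (hα₂ : Measurable α₂)
    (h : ∀ v : ℝ, 0 < v → (∫ p, k₁ p * exp (-I * (v * α₁ p))) +
      ∫ p, k₂ p * exp (-I * (v * α₂ p)) = 0) {l : ℂ} (hl : 0 < l.re) :
    (∫ p, k₁ p * (l + I * α₁ p)⁻¹) + ∫ p, k₂ p * (l + I * α₂ p)⁻¹ = 0 := by
  rw [← integral_laplace_phase hk₁ hα₁ hl, ← integral_laplace_phase hk₂ hα₂ hl]
  refine (integral_add (integrable_laplace_phase hk₁ hα₁ hl).integral_prod_left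
      (integrable_laplace_phase hk₂ hα₂ hl).integral_prod_left).symm.trans ?_
  rw [setIntegral_congr_fun (g := fun _ => 0) measurableSet_Ioi, integral_zero]
  intro v hv
  simp only [integral_const_mul, Function.uncurry]
  rw [← mul_add, h v hv, mul_zero]

theorem integral_double_resolvent_pair_eq_zero {k₁ k₂ : ℝ → ℂ} (hk₁ : Integrable k₁)
    (hk₂ : Integrable k₂) {α₁ α₂ β₁ β₂ : ℝ → ℝ} (hα₁ : Measurable α₁) (hα₂ : Measurable α₂)
    (hβ₁ : Measurable β₁) (hβ₂ : Measurable β₂)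
    (h : ∀ v u : ℝ, 0 < v → 0 < u →
      (∫ p, k₁ p * exp (-I * (u * β₁ p)) * exp (-I * (v * α₁ p))) +
      ∫ p, k₂ p * exp (-I * (u * β₂ p)) * exp (-I * (v * α₂ p)) = 0)
    {l κ : ℂ} (hl : 0 < l.re) (hκ : 0 < κ.re) :
    (∫ p, k₁ p * ((l + I * α₁ p)⁻¹ * (κ + I * β₁ p)⁻¹)) +
      ∫ p, k₂ p * ((l + I * α₂ p)⁻¹ * (κ + I * β₂ p)⁻¹) = 0 := by
  simp_rw [← mul_assoc]
  refine integral_resolvent_pair_eq_zero (integrable_mul_inv_add hk₁ hα₁ hl)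
    (integrable_mul_inv_add hk₂ hα₂ hl) hβ₁ hβ₂ (fun u hu => ?_) hκ
  simp_rw [mul_right_comm _ (_⁻¹)]
  exact integral_resolvent_pair_eq_zero (integrable_mul_exp_phase hk₁ hβ₁ u)
    (integrable_mul_exp_phase hk₂ hβ₂ u) hα₁ hα₂ (fun v hv => h v u hv hu) hl

/-- The product of the two resolvents with light-cone momenta `s` and `M / s` is a Poisson
kernel. -/
theorem resolvent_mul_resolvent_eq_poisson {s t M x ε : ℝ} (hst : s * t = M) (hM : 0 < M)
    (hε : 0 < ε) :
    (((ε - I * x : ℂ)) + I * s)⁻¹ * ((M / (ε + I * x) : ℂ) + I * t)⁻¹ =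
      (ε + I * x) / (I * M) * (s * ((s - x) ^ 2 + ε ^ 2)⁻¹ : ℝ) := by
  have hs : s ≠ 0 := fun h => by simp [h] at hst; exact hM.ne hst
  have hl : (ε + I * x : ℂ) ≠ 0 := fun h => by
    have := congrArg re h
    simp at this
    exact hε.ne' this
  have h1 : (ε - I * x : ℂ) + I * s = I * ((s - x : ℝ) - I * ε) := by
    push_cast; linear_combination (ε : ℂ) * I_sq
  have hsC : (s : ℂ) ≠ 0 := by exact_mod_cast hs
  have h2 : (M / (ε + I * x) : ℂ) + I * t = M / ((ε + I * x) * s) * ((s - x : ℝ) + I * ε) := by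
    have : (M : ℂ) = s * t := by exact_mod_cast hst.symm
    rw [this]
    field_simp
    push_cast
    linear_combination (t : ℂ) * x * I_sq
  rw [h1, h2, ← mul_inv]
  have h3 : I * ((s - x : ℝ) - I * ε) * (M / ((ε + I * x) * s) * ((s - x : ℝ) + I * ε)) =
     I * M / ((ε + I * x) * s) * ((s - x) ^ 2 + ε ^ 2 : ℝ) := by
    push_cast
    linear_combination -(I * M / ((ε + I * x) * s)) * (ε : ℂ) ^ 2 * I_sq
  rw [h3, mul_inv, inv_div]
  push_cast
  ring

theorem intervalIntegral_poisson {a b c ε : ℝ} (hε : 0 < ε) :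
    ∫ x in a..b, ε * ((c - x) ^ 2 + ε ^ 2)⁻¹ =
      Real.arctan ((b - c) / ε) - Real.arctan ((a - c) / ε) := by
  have hpos : ∀ x, 0 < (c - x) ^ 2 + ε ^ 2 := fun x => by positivity
  refine intervalIntegral.integral_eq_sub_of_hasDerivAt (f := fun x => Real.arctan ((x - c) / ε))
    (fun x _ => ?_) ?_
  · have := (((hasDerivAt_id x).sub_const c).div_const ε).arctan
    convert! this using 1
    have := (hpos x).ne'
    simp only [id]
    field_simp
    ring
  · refine Continuous.intervalIntegrable ?_ _ _
    exact continuous_const.mul (Continuous.inv₀ (by fun_prop) fun x => (hpos x).ne')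

theorem tendsto_arctan_div_nhdsGT_zero (t : ℝ) :
    Tendsto (fun ε : ℝ => Real.arctan (t / ε)) (𝓝[>] 0) (𝓝 (Real.sign t * (Real.pi / 2))) := by
  rcases lt_trichotomy t 0 with h | h | h
  · rw [Real.sign_of_neg h, neg_one_mul]
    refine (Real.tendsto_arctan_atBot.mono_right nhdsWithin_le_nhds).comp ?_
    exact tendsto_inv_nhdsGT_zero.const_mul_atTop_of_neg h
  · simp [h]
  · rw [Real.sign_of_pos h, one_mul]
    refine (Real.tendsto_arctan_atTop.mono_right nhdsWithin_le_nhds).comp ?_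
    exact tendsto_inv_nhdsGT_zero.const_mul_atTop h

theorem intervalIntegral_integral_poisson {K : ℝ → ℂ} (hK : Integrable K) {α : ℝ → ℝ}
    (hα : Measurable α) {a b ε : ℝ} (hε : 0 < ε) :
    ∫ x in a..b, ∫ p, K p * (ε * ((α p - x) ^ 2 + ε ^ 2)⁻¹ : ℝ) =
      ∫ p, K p * (Real.arctan ((b - α p) / ε) - Real.arctan ((a - α p) / ε) : ℝ) := by
  rw [intervalIntegral_integral_swap]
  · refine integral_congr_ae (Eventually.of_forall fun p => ?_)
    simp only [intervalIntegral.integral_const_mul, intervalIntegral.integral_ofReal]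
    rw [← intervalIntegral_poisson hε, intervalIntegral.integral_const_mul]
  · have h1 : Integrable (fun _ : ℝ => (1 : ℂ)) (volume.restrict (uIoc a b)) :=
      (continuous_const : Continuous fun _ : ℝ => (1 : ℂ)).integrableOn_uIoc
    refine ((h1.mul_prod hK).mul_bdd (c := ε⁻¹)
      (g := fun x : ℝ × ℝ => ((ε * ((α x.2 - x.1) ^ 2 + ε ^ 2)⁻¹ : ℝ) : ℂ)) ?_ ?_).congr ?_
    · exact Measurable.aestronglyMeasurable (by fun_prop)
    · refine Eventually.of_forall fun x => ?_
      rw [norm_real, Real.norm_of_nonneg (by positivity), ← div_eq_mul_inv, div_le_iff₀ (by positivity),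
        mul_add]
      have : ε⁻¹ * ε ^ 2 = ε := by field_simp
      rw [this]
      exact le_add_of_nonneg_left (by positivity)
    · exact Eventually.of_forall fun x => by simp [Function.uncurry]

theorem tendsto_integral_arctan {K : ℝ → ℂ} (hK : Integrable K) {α : ℝ → ℝ}
    (hα : Measurable α) (a b : ℝ) :
    Tendsto (fun ε : ℝ =>
      ∫ p, K p * (Real.arctan ((b - α p) / ε) - Real.arctan ((a - α p) / ε) : ℝ)) (𝓝[>] 0)
      (𝓝 (∫ p, K p * (Real.sign (b - α p) * (Real.pi / 2) -
        Real.sign (a - α p) * (Real.pi / 2) : ℝ))) := by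
  refine tendsto_integral_filter_of_dominated_convergence (fun p => ‖K p‖ * Real.pi) ?_ ?_
    (hK.norm.mul_const _) ?_
  · refine Eventually.of_forall fun ε => hK.aestronglyMeasurable.mul ?_
    exact Measurable.aestronglyMeasurable (by fun_prop)
  · refine Eventually.of_forall fun ε => Eventually.of_forall fun p => ?_
    rw [norm_mul]
    gcongr
    rw [norm_real, Real.norm_eq_abs, abs_le]
    have h1 := Real.arctan_lt_pi_div_two ((b - α p) / ε)
    have h2 := Real.arctan_lt_pi_div_two ((a - α p) / ε)
    have h3 := Real.neg_pi_div_two_lt_arctan ((b - α p) / ε)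
    have h4 := Real.neg_pi_div_two_lt_arctan ((a - α p) / ε)
    constructor <;> linarith
  · refine Eventually.of_forall fun p => Tendsto.const_mul _ ?_
    exact (continuous_ofReal.tendsto _).comp
      ((tendsto_arctan_div_nhdsGT_zero _).sub (tendsto_arctan_div_nhdsGT_zero _))

theorem integral_lightCone_sign_eq_zero {k₁ k₂ : ℝ → ℂ} (hk₁ : Integrable k₁)
    (hk₂ : Integrable k₂) {P Q : ℝ → ℝ} (hP : Measurable P) (hQ : Measurable Q)
    (hPpos : ∀ p, 0 < P p) {M : ℝ} (hM : 0 < M) (hPQ : ∀ p, P p * Q p = M)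
    (hK₁ : Integrable fun p => k₁ p * P p) (hK₂ : Integrable fun p => k₂ p * P p)
    (h : ∀ v u : ℝ, 0 < v → 0 < u →
      (∫ p, k₁ p * exp (-I * (v * P p + u * Q p))) +
      ∫ p, k₂ p * exp (I * (v * P p + u * Q p)) = 0)
    {a b : ℝ} (ha : 0 < a) (hb : 0 < b) :
    ∫ p, k₁ p * P p * (Real.sign (b - P p) * (Real.pi / 2) -
        Real.sign (a - P p) * (Real.pi / 2) : ℝ) = 0 := by
  have key : ∀ ε : ℝ, 0 < ε → ∀ x : ℝ,
      ∫ p, k₁ p * P p * (ε * ((P p - x) ^ 2 + ε ^ 2)⁻¹ : ℝ) =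
      ∫ p, k₂ p * P p * (ε * ((-P p - x) ^ 2 + ε ^ 2)⁻¹ : ℝ) := by
    intro ε hε x
    have hl : (0 : ℝ) < (ε - I * x : ℂ).re := by simpa using hε
    have hκ : (0 : ℝ) < (M / (ε + I * x) : ℂ).re := by
      have : (ε + I * x : ℂ) ≠ 0 := fun h => by
        have := congrArg re h
        simp at this
        exact hε.ne' this
      rw [div_re]
      have := normSq_pos.2 this
      simp only [ofReal_re, ofReal_im, add_re, mul_re, I_re, I_im]
      simp only [zero_mul, zero_div, mul_zero, sub_zero, add_zero]
      positivity
    have := integral_double_resolvent_pair_eq_zero hk₁ hk₂ hP hP.neg hQ hQ.neg (fun v u hv hu => ?_)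
      hl hκ
    · have h2 : ∀ p, (-P p) * (-Q p) = M := fun p => by rw [neg_mul_neg, hPQ]
      simp only [Pi.neg_apply, resolvent_mul_resolvent_eq_poisson (hPQ _) hM hε,
        resolvent_mul_resolvent_eq_poisson (h2 _) hM hε] at this
      have hc : (ε + I * x : ℂ) / (I * M) ≠ 0 := by
        refine div_ne_zero (fun h => ?_) (mul_ne_zero I_ne_zero (by exact_mod_cast hM.ne'))
        have := congrArg re h
        simp at this
        exact hε.ne' this
      simp only [mul_left_comm (k₁ _), mul_left_comm (k₂ _), integral_const_mul] at this
      rw [← mul_add, mul_eq_zero, or_iff_right hc] at this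
      have e1 : ∀ p, k₁ p * P p * (ε * ((P p - x) ^ 2 + ε ^ 2)⁻¹ : ℝ) =
        ε * (k₁ p * (P p * ((P p - x) ^ 2 + ε ^ 2)⁻¹ : ℝ)) := fun p => by push_cast; ring
      have e2 : ∀ p, k₂ p * P p * (ε * ((-P p - x) ^ 2 + ε ^ 2)⁻¹ : ℝ) =
        -ε * (k₂ p * (-P p * ((-P p - x) ^ 2 + ε ^ 2)⁻¹ : ℝ)) := fun p => by push_cast; ring
      simp only [e1, e2, integral_const_mul]
      linear_combination (ε : ℂ) * this
    · rw [← h v u hv hu]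
      simp only [mul_assoc, ← exp_add, Pi.neg_apply, ofReal_neg]
      congr 1
      · congr! 4; ring
      · congr! 4; ring
  have key2 : ∀ᶠ ε : ℝ in 𝓝[>] 0,
      ∫ p, k₁ p * P p * (Real.arctan ((b - P p) / ε) - Real.arctan ((a - P p) / ε) : ℝ) =
      ∫ p, k₂ p * P p * (Real.arctan ((b - -P p) / ε) - Real.arctan ((a - -P p) / ε) : ℝ) := by
    filter_upwards [self_mem_nhdsWithin] with ε hε
    have e1 := intervalIntegral_integral_poisson hK₁ hP (a := a) (b := b) hε
    have e2 := intervalIntegral_integral_poisson hK₂ hP.neg (a := a) (b := b) hε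
    simp only [Pi.neg_apply] at e2
    rw [← e1, ← e2]
    simp only [key ε hε]
  have t1 := tendsto_integral_arctan hK₁ hP a b
  have t2 := tendsto_integral_arctan hK₂ hP.neg a b
  simp only [Pi.neg_apply] at t2
  rw [tendsto_nhds_unique (t1.congr' key2) t2]
  refine integral_eq_zero_of_ae (Eventually.of_forall fun p => ?_)
  have hp := hPpos p
  simp [Real.sign_of_pos (show 0 < b + P p by positivity),
    Real.sign_of_pos (show 0 < a + P p by positivity)]

theorem ae_eq_zero_of_lightCone_integral_eq_zero {k₁ k₂ : ℝ → ℂ} (hk₁ : Integrable k₁)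
    (hk₂ : Integrable k₂) {P Q : ℝ → ℝ} (hP : Measurable P) (hQ : Measurable Q)
    (hPmono : StrictMono P)
    (hPpos : ∀ p, 0 < P p) {M : ℝ} (hM : 0 < M) (hPQ : ∀ p, P p * Q p = M)
    (hK₁ : Integrable fun p => k₁ p * P p) (hK₂ : Integrable fun p => k₂ p * P p)
    (h : ∀ v u : ℝ, 0 < v → 0 < u →
      (∫ p, k₁ p * exp (-I * (v * P p + u * Q p))) +
      ∫ p, k₂ p * exp (I * (v * P p + u * Q p)) = 0) :
    k₁ =ᵐ[volume] 0 := by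
  have hint : ∀ c d : ℝ, ∫ p in c..d, k₁ p * P p = 0 := by
    suffices ∀ c d : ℝ, c ≤ d → ∫ p in c..d, k₁ p * P p = 0 by
      intro c d
      rcases le_total c d with hcd | hcd
      · exact this c d hcd
      · rw [intervalIntegral.integral_symm, this d c hcd, neg_zero]
    intro c d hcd
    have h0 := integral_lightCone_sign_eq_zero hk₁ hk₂ hP hQ hPpos hM hPQ hK₁ hK₂ h
      (hPpos c) (hPpos d)
    have hpi : (Real.pi : ℂ) ≠ 0 := by exact_mod_cast Real.pi_ne_zero
    rw [intervalIntegral.integral_of_le hcd, ← integral_indicator measurableSet_Ioc]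
    refine (mul_eq_zero.1 ?_).resolve_left hpi
    rw [← integral_const_mul, ← h0]
    refine integral_congr_ae ?_
    filter_upwards [Measure.ae_ne volume c, Measure.ae_ne volume d] with p hpc hpd
    rcases lt_or_gt_of_ne hpc with h1 | h1
    · have h2 := hPmono h1
      have h3 := hPmono (h1.trans_le hcd)
      rw [indicator_of_notMem (fun h => h1.not_gt h.1), Real.sign_of_pos (sub_pos.2 h2),
        Real.sign_of_pos (sub_pos.2 h3)]
      simp
    · have h2 := hPmono h1
      rcases lt_or_gt_of_ne hpd with h3 | h3
      · rw [indicator_of_mem (show p ∈ Ioc c d from ⟨h1, h3.le⟩), Real.sign_of_neg (sub_neg.2 h2),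
          Real.sign_of_pos (sub_pos.2 (hPmono h3))]
        push_cast
        ring
      · rw [indicator_of_notMem (fun h => h3.not_ge h.2), Real.sign_of_neg (sub_neg.2 h2),
          Real.sign_of_neg (sub_neg.2 (hPmono h3))]
        simp
  filter_upwards [LocallyIntegrable.ae_hasDerivAt_integral hK₁.locallyIntegrable] with p hp
  have h1 := hp 0
  simp only [hint] at h1
  have h2 := h1.unique (hasDerivAt_const p (0 : ℂ))
  exact (mul_eq_zero.1 h2).resolve_right (by exact_mod_cast (hPpos p).ne')

theorem integrable_mul_exp_of_testFunction {f : ℝ × ℝ → ℝ} (hf : Continuous f)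
    (hs : HasCompactSupport f) {g : ℝ × ℝ → ℂ} (hg : Continuous g) :
    Integrable fun a => (f a : ℂ) * g a := by
  refine Continuous.integrable_of_hasCompactSupport (by fun_prop) ?_
  exact (hs.comp_left (g := fun x : ℝ => (x : ℂ)) ofReal_zero).mul_right

/-- Differentiating in the time direction multiplies the mass-shell restriction by `i ω_m`. -/
theorem massShellRestriction_fderiv (m : ℝ) {f : ℝ × ℝ → ℝ} (hf : ContDiff ℝ (⊤ : ℕ∞) f)
    (hs : HasCompactSupport f) (p : ℝ) :
    massShellRestriction m (fun a => fderiv ℝ f a (1, 0)) p =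
      I * (Real.sqrt (m ^ 2 + p ^ 2) : ℝ) * massShellRestriction m f p := by
  unfold massShellRestriction
  set w : ℝ := Real.sqrt (m ^ 2 + p ^ 2)
  set e : ℝ × ℝ → ℂ := fun a => exp (-I * ((a.1 : ℂ) * (w : ℝ) - (a.2 : ℂ) * p)) with he
  have hed : Differentiable ℝ e := by
    have h1 : Differentiable ℝ fun a : ℝ × ℝ => (a.1 : ℂ) :=
      ofRealCLM.differentiable.comp differentiable_fst
    have h2 : Differentiable ℝ fun a : ℝ × ℝ => (a.2 : ℂ) :=
      ofRealCLM.differentiable.comp differentiable_snd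
    fun_prop
  have hfd : Continuous fun a => fderiv ℝ f a (1, 0) :=
    (hf.continuous_fderiv (by simp)).clm_apply continuous_const
  have hde : ∀ a, fderiv ℝ e a (1, 0) = -I * w * e a := by
    intro a
    have h1 : HasDerivAt (fun t : ℝ => e (a + t • ((1 : ℝ), (0 : ℝ)))) (fderiv ℝ e a (1, 0)) 0 :=
      (hed a).hasFDerivAt.hasLineDerivAt (1, 0)
    refine h1.unique ?_
    have h2 : HasDerivAt (fun t : ℝ => -I * (((a.1 + t : ℝ) : ℂ) * w - a.2 * p)) (-I * (1 * w)) 0 :=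
      (((((hasDerivAt_id (0 : ℝ)).const_add a.1).ofReal_comp).mul_const (w : ℂ)).sub_const
        ((a.2 : ℂ) * p)).const_mul (-I) |>.congr_deriv (by simp)
    convert! h2.cexp using 1
    · ext t; simp [he]
    · simp [he]; ring
  have hec : Continuous e := hed.continuous
  have key := integral_smul_fderiv_eq_neg_fderiv_smul_of_integrable (μ := volume) (𝕜 := ℝ)
    (f := f) (g := e) (v := ((1 : ℝ), (0 : ℝ))) ?_ ?_ ?_
    (fun x _ => hf.differentiable (by simp) x) (fun x _ => hed x)
  · simp only [hde, real_smul] at key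
    have h3 : ∀ a, (f a : ℂ) * (-I * w * e a) = (-I * w) * (f a * e a) := fun a => by ring
    simp only [h3, integral_const_mul] at key
    simp only [he] at key
    linear_combination ((1 / (2 * Real.pi)) : ℂ) * key
  · simp only [real_smul]
    exact integrable_mul_exp_of_testFunction hfd (hs.fderiv_apply ℝ _) hec
  · simp only [real_smul, hde]
    exact integrable_mul_exp_of_testFunction hf.continuous hs (by fun_prop)
  · simp only [real_smul]
    exact integrable_mul_exp_of_testFunction hf.continuous hs hec

theorem norm_massShellRestriction_le (m : ℝ) (f : ℝ × ℝ → ℝ) (p : ℝ) :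
    ‖massShellRestriction m f p‖ ≤ ‖(1 / (2 * Real.pi) : ℂ)‖ * ∫ a, ‖f a‖ := by
  unfold massShellRestriction
  rw [norm_mul]
  gcongr
  refine (norm_integral_le_integral_norm _).trans_eq ?_
  refine integral_congr_ae (Eventually.of_forall fun a => ?_)
  simp only [norm_mul, norm_real, norm_exp]
  simp [-Prod.forall]

theorem exists_norm_massShellRestriction_mul_le (m : ℝ) {f : ℝ × ℝ → ℝ}
    (hf : ContDiff ℝ (⊤ : ℕ∞) f) (hs : HasCompactSupport f) :
    ∃ C, ∀ p, ‖massShellRestriction m f p‖ * Real.sqrt (m ^ 2 + p ^ 2) ^ 2 ≤ C := by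
  have hf' : ContDiff ℝ (⊤ : ℕ∞) fun a => fderiv ℝ f a (1, 0) :=
    (hf.fderiv_right (m := (⊤ : ℕ∞)) (by simp)).clm_apply contDiff_const
  have hs' : HasCompactSupport fun a => fderiv ℝ f a (1, 0) := hs.fderiv_apply ℝ _
  refine ⟨_, fun p => le_trans (le_of_eq ?_) (norm_massShellRestriction_le m
    (fun a => fderiv ℝ (fun a => fderiv ℝ f a (1, 0)) a (1, 0)) p)⟩
  rw [massShellRestriction_fderiv m hf' hs', massShellRestriction_fderiv m hf hs]
  simp only [norm_mul, norm_I, norm_real, Real.norm_eq_abs, abs_of_nonneg (Real.sqrt_nonneg _)]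
  ring

theorem measurable_massShellRestriction (m : ℝ) {f : ℝ × ℝ → ℝ} (hf : Continuous f) :
    Measurable (massShellRestriction m f) := by
  unfold massShellRestriction
  refine Measurable.const_mul ?_ _
  refine (StronglyMeasurable.integral_prod_right (f := fun (p : ℝ) (a : ℝ × ℝ) => (f a : ℂ) *
      exp (-I * ((a.1 : ℂ) * (Real.sqrt (m ^ 2 + p ^ 2) : ℝ) - (a.2 : ℂ) * p))) ?_).measurable
  refine Continuous.stronglyMeasurable ?_
  unfold Function.uncurry
  fun_prop

theorem massShellRestriction_translate (m : ℝ) (f : ℝ × ℝ → ℝ) (b : ℝ × ℝ) (p : ℝ) :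
    massShellRestriction m (fun a => f (a - b)) p =
      exp (-I * ((b.1 : ℂ) * (Real.sqrt (m ^ 2 + p ^ 2) : ℝ) - (b.2 : ℂ) * p)) *
        massShellRestriction m f p := by
  unfold massShellRestriction
  rw [mul_left_comm]
  congr 1
  rw [← integral_const_mul, ← integral_add_right_eq_self _ b]
  refine integral_congr_ae (Eventually.of_forall fun a => ?_)
  simp only [add_sub_cancel_right]
  rw [mul_left_comm, ← exp_add]
  congr 2
  simp
  ring

theorem massShellRestriction_ne_zero (m : ℝ) {f : ℝ × ℝ → ℝ} (hf : Continuous f)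
    (hs : HasCompactSupport f) (hf0 : ∀ a, 0 ≤ f a) (hne : f ≠ 0) (p : ℝ)
    (hsmall : ∀ a, f a ≠ 0 → |a.1 * Real.sqrt (m ^ 2 + p ^ 2) - a.2 * p| ≤ 1) :
    massShellRestriction m f p ≠ 0 := by
  unfold massShellRestriction
  refine mul_ne_zero (by simp [Real.pi_ne_zero]) fun h0 => ?_
  have hint := integrable_mul_exp_of_testFunction hf hs
    (g := fun a => exp (-I * ((a.1 : ℂ) * (Real.sqrt (m ^ 2 + p ^ 2) : ℝ) - (a.2 : ℂ) * p)))
    (by fun_prop)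
  have hre : ∀ a : ℝ × ℝ, ((f a : ℂ) *
      exp (-I * ((a.1 : ℂ) * (Real.sqrt (m ^ 2 + p ^ 2) : ℝ) - (a.2 : ℂ) * p))).re =
      f a * Real.cos (a.1 * Real.sqrt (m ^ 2 + p ^ 2) - a.2 * p) := by
    intro a
    rw [re_ofReal_mul, exp_re, ← Real.cos_neg]
    simp
  have h1 := integral_re hint
  simp only [RCLike.re_to_complex, hre, h0, zero_re] at h1
  have hcos : ∀ a, f a ≠ 0 → 0 < Real.cos (a.1 * Real.sqrt (m ^ 2 + p ^ 2) - a.2 * p) :=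
    fun a ha => Real.cos_pos_of_le_one (hsmall a ha)
  obtain ⟨a, ha⟩ := Function.ne_iff.1 hne
  refine (Continuous.integral_pos_of_hasCompactSupport_nonneg_nonzero (μ := volume)
    (f := fun a : ℝ × ℝ => f a * Real.cos (a.1 * Real.sqrt (m ^ 2 + p ^ 2) - a.2 * p))
    (by fun_prop) hs.mul_right (fun a => ?_) (x := a)
    (mul_ne_zero ha (hcos a ha).ne')).ne' h1
  by_cases h : f a = 0
  · simp [h]
  · exact mul_nonneg (hf0 a) (hcos a h).le

theorem sqrt_massShell_pos {m : ℝ} (hm : 0 < m) (p : ℝ) : 0 < Real.sqrt (m ^ 2 + p ^ 2) :=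
  Real.sqrt_pos.2 (by positivity)

theorem integrable_massShellMeasure_iff (m : ℝ) {g : ℝ → ℂ} :
    Integrable g (massShellMeasure m) ↔
      Integrable fun p => ((1 / (2 * Real.sqrt (m ^ 2 + p ^ 2)) : ℝ) : ℂ) * g p := by
  unfold massShellMeasure
  rw [integrable_withDensity_iff_integrable_smul' (by fun_prop)
    (Eventually.of_forall fun _ => ENNReal.ofReal_lt_top)]
  refine integrable_congr (Eventually.of_forall fun p => ?_)
  simp only [real_smul]
  rw [ENNReal.toReal_ofReal (by positivity)]

theorem integral_massShellMeasure (m : ℝ) (g : ℝ → ℂ) :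
    ∫ p, g p ∂massShellMeasure m =
      ∫ p, ((1 / (2 * Real.sqrt (m ^ 2 + p ^ 2)) : ℝ) : ℂ) * g p := by
  unfold massShellMeasure
  rw [integral_withDensity_eq_integral_toReal_smul (by fun_prop)
    (Eventually.of_forall fun _ => ENNReal.ofReal_lt_top)]
  refine integral_congr_ae (Eventually.of_forall fun p => ?_)
  simp only [real_smul]
  rw [ENNReal.toReal_ofReal (by positivity)]

theorem memLp_two_massShellMeasure {m : ℝ} (hm : 0 < m) {g : ℝ → ℂ} (hg : Measurable g) {C : ℝ}
    (hC : ∀ p, ‖g p‖ * Real.sqrt (m ^ 2 + p ^ 2) ≤ C) : MemLp g 2 (massShellMeasure m) := by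
  rw [memLp_two_iff_integrable_sq_norm hg.aestronglyMeasurable]
  unfold massShellMeasure
  rw [integrable_withDensity_iff_integrable_smul' (by fun_prop)
    (Eventually.of_forall fun _ => ENNReal.ofReal_lt_top)]
  have hdom : Integrable fun p : ℝ => C ^ 2 / (2 * m) * (m ^ 2 + p ^ 2)⁻¹ := by
    have h := (integrable_inv_one_add_sq.comp_div hm.ne').const_mul (C ^ 2 / (2 * m) * (m ^ 2)⁻¹)
    refine h.congr (Eventually.of_forall fun p => ?_)
    have : 0 < m ^ 2 + p ^ 2 := by positivity
    simp only
    field_simp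
  refine hdom.mono' (Measurable.aestronglyMeasurable (by fun_prop)) ?_
  refine Eventually.of_forall fun p => ?_
  rw [ENNReal.toReal_ofReal (by positivity), smul_eq_mul, Real.norm_of_nonneg (by positivity)]
  have hw := sqrt_massShell_pos hm p
  have hwm : m ≤ Real.sqrt (m ^ 2 + p ^ 2) := Real.le_sqrt_of_sq_le (by nlinarith)
  have hsq : Real.sqrt (m ^ 2 + p ^ 2) ^ 2 = m ^ 2 + p ^ 2 := Real.sq_sqrt (by positivity)
  have h1 : ‖g p‖ ^ 2 * Real.sqrt (m ^ 2 + p ^ 2) ^ 2 ≤ C ^ 2 := by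
    rw [← mul_pow]
    exact pow_le_pow_left₀ (by positivity) (hC p) 2
  have h2 : ‖g p‖ ^ 2 ≤ C ^ 2 * (Real.sqrt (m ^ 2 + p ^ 2) ^ 2)⁻¹ := by
    rwa [← div_eq_mul_inv, le_div_iff₀ (by positivity)]
  have h3 : 1 / (2 * Real.sqrt (m ^ 2 + p ^ 2)) ≤ 1 / (2 * m) := by gcongr
  calc _ ≤ 1 / (2 * m) * (C ^ 2 * (Real.sqrt (m ^ 2 + p ^ 2) ^ 2)⁻¹) := by gcongr
    _ = _ := by rw [hsq]; ring

theorem strictMono_sqrt_add {m : ℝ} (hm : 0 < m) :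
    StrictMono fun p : ℝ => Real.sqrt (m ^ 2 + p ^ 2) + p := by
  intro p q hpq
  have hq := sqrt_massShell_pos hm q
  have hsq : Real.sqrt (m ^ 2 + q ^ 2) ^ 2 = m ^ 2 + q ^ 2 := Real.sq_sqrt (by positivity)
  have hlt : -q < Real.sqrt (m ^ 2 + q ^ 2) :=
    Real.lt_sqrt_of_sq_lt (by nlinarith)
  have : Real.sqrt (m ^ 2 + p ^ 2) < Real.sqrt (m ^ 2 + q ^ 2) + (q - p) := by
    rw [Real.sqrt_lt' (by linarith)]
    nlinarith [mul_pos (sub_pos.2 hpq) (neg_lt_iff_pos_add.1 hlt)]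
  simp only
  linarith

theorem abs_lt_sqrt_massShell {m : ℝ} (hm : 0 < m) (p : ℝ) : |p| < Real.sqrt (m ^ 2 + p ^ 2) :=
  Real.lt_sqrt_of_sq_lt (by rw [sq_abs]; nlinarith)

theorem ae_eq_zero_of_re_integral_forwardCone_eq_zero {m : ℝ} (hm : 0 < m) {k : ℝ → ℂ}
    (hk : Integrable k) (hkw : Integrable fun p => k p * (Real.sqrt (m ^ 2 + p ^ 2) : ℝ))
    (h : ∀ a ∈ forwardCone,
      (∫ p, k p * exp (-I * ((a.1 : ℂ) * (Real.sqrt (m ^ 2 + p ^ 2) : ℝ) - (a.2 : ℂ) * p))).re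
        = 0) :
    k =ᵐ[volume] 0 := by
  have hlt := fun p => abs_lt.1 (abs_lt_sqrt_massShell hm p)
  have hsq : ∀ p : ℝ, Real.sqrt (m ^ 2 + p ^ 2) ^ 2 = m ^ 2 + p ^ 2 :=
    fun p => Real.sq_sqrt (by positivity)
  have hK : Integrable fun p => k p * (Real.sqrt (m ^ 2 + p ^ 2) + p : ℝ) := by
    refine (hkw.norm.const_mul 2).mono' (hk.aestronglyMeasurable.mul
      (Measurable.aestronglyMeasurable (by fun_prop))) (Eventually.of_forall fun p => ?_)
    rw [norm_mul, norm_mul, norm_real, norm_real, Real.norm_of_nonneg (Real.sqrt_nonneg _),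
      Real.norm_of_nonneg (by linarith [hlt p])]
    have := mul_le_mul_of_nonneg_left (hlt p).2.le (norm_nonneg (k p))
    linarith
  have conj_int : Integrable fun p => (starRingEnd ℂ) (k p) :=
    (conjCLE : ℂ →L[ℝ] ℂ).integrable_comp hk
  have conj_intK : Integrable fun p =>
      (starRingEnd ℂ) (k p) * (Real.sqrt (m ^ 2 + p ^ 2) + p : ℝ) := by
    refine ((conjCLE : ℂ →L[ℝ] ℂ).integrable_comp hK).congr (Eventually.of_forall fun p => ?_)
    simp [-ofReal_add]
  refine ae_eq_zero_of_lightCone_integral_eq_zero hk conj_int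
    (P := fun p => Real.sqrt (m ^ 2 + p ^ 2) + p) (Q := fun p => Real.sqrt (m ^ 2 + p ^ 2) - p)
    (by fun_prop) (by fun_prop) (strictMono_sqrt_add hm) (fun p => by linarith [hlt p])
    (M := m ^ 2) (by positivity) (fun p => by linear_combination hsq p) hK conj_intK ?_
  intro v u hv hu
  have h0 := h (v + u, u - v) (by
    simp only [forwardCone, Set.mem_ofPred_eq]
    exact abs_lt.2 ⟨by linarith, by linarith⟩)
  have e1 : ∀ p, exp (I * (v * (Real.sqrt (m ^ 2 + p ^ 2) + p : ℝ) +
      u * (Real.sqrt (m ^ 2 + p ^ 2) - p : ℝ))) =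
      (starRingEnd ℂ) (exp (-I * (v * (Real.sqrt (m ^ 2 + p ^ 2) + p : ℝ) +
      u * (Real.sqrt (m ^ 2 + p ^ 2) - p : ℝ)))) := by
    intro p
    rw [← exp_conj]
    simp
  simp only [e1, ← map_mul]
  rw [integral_conj, add_conj]
  have e2 : ∀ p : ℝ, -I * (v * (Real.sqrt (m ^ 2 + p ^ 2) + p : ℝ) +
      u * (Real.sqrt (m ^ 2 + p ^ 2) - p : ℝ)) =
      -I * (((v + u : ℝ) : ℂ) * (Real.sqrt (m ^ 2 + p ^ 2) : ℝ) - ((u - v : ℝ) : ℂ) * p) := by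
    intro p; push_cast; ring
  simp only [e2, h0]
  simp

theorem memLp_massShellRestriction {m : ℝ} (hm : 0 < m) {f : ℝ × ℝ → ℝ}
    (hf : ContDiff ℝ (⊤ : ℕ∞) f) (hs : HasCompactSupport f) :
    MemLp (massShellRestriction m f) 2 (massShellMeasure m) := by
  obtain ⟨C, hC⟩ := exists_norm_massShellRestriction_mul_le m hf hs
  refine memLp_two_massShellMeasure hm (measurable_massShellRestriction m hf.continuous)
    (C := C / m) fun p => ?_
  rw [le_div_iff₀ hm]
  refine le_trans ?_ (hC p)
  rw [sq (Real.sqrt _), ← mul_assoc]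
  gcongr
  exact Real.le_sqrt_of_sq_le (by nlinarith)

theorem conj_mul_massShellRestriction_ae_eq_zero {m : ℝ} (hm : 0 < m)
    (h : Lp ℂ 2 (massShellMeasure m)) {f : ℝ × ℝ → ℝ} (hf : ContDiff ℝ (⊤ : ℕ∞) f)
    (hs : HasCompactSupport f) {s : ℝ} (hs1 : s = 1 ∨ s = -1)
    (horth : ∀ a ∈ forwardCone, (∫ p, (starRingEnd ℂ) (h p) *
      massShellRestriction m (fun x => f (x - s • a)) p ∂massShellMeasure m).re = 0) :
    ∀ᵐ p, (starRingEnd ℂ) (h p) * massShellRestriction m f p = 0 := by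
  obtain ⟨C, hC⟩ := exists_norm_massShellRestriction_mul_le m hf hs
  have hmeas := measurable_massShellRestriction m hf.continuous
  have hconj : MemLp (fun p => (starRingEnd ℂ) (h p)) 2 (massShellMeasure m) :=
    (Lp.memLp h).star
  have hF1 : MemLp (fun p => massShellRestriction m f p * (Real.sqrt (m ^ 2 + p ^ 2) : ℝ)) 2
      (massShellMeasure m) := by
    refine memLp_two_massShellMeasure hm (by fun_prop) (C := C) fun p => ?_
    rw [norm_mul, norm_real, Real.norm_of_nonneg (Real.sqrt_nonneg _), mul_assoc, ← sq]
    exact hC p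
  have hF0 := memLp_massShellRestriction hm hf hs
  set k : ℝ → ℂ := fun p => ((1 / (2 * Real.sqrt (m ^ 2 + p ^ 2)) : ℝ) : ℂ) *
    ((starRingEnd ℂ) (h p) * massShellRestriction m f p) with hkdef
  have hk : Integrable k := (integrable_massShellMeasure_iff m).1 (hconj.integrable_mul hF0)
  have hkw : Integrable fun p => k p * (Real.sqrt (m ^ 2 + p ^ 2) : ℝ) := by
    refine ((integrable_massShellMeasure_iff m).1 (hconj.integrable_mul hF1)).congr
      (Eventually.of_forall fun p => ?_)
    simp only [hkdef, Pi.mul_apply]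
    ring
  have hzero : ∀ a ∈ forwardCone, (∫ p, k p *
      exp (-I * (((s * a.1 : ℝ) : ℂ) * (Real.sqrt (m ^ 2 + p ^ 2) : ℝ) -
        ((s * a.2 : ℝ) : ℂ) * p))).re = 0 := by
    intro a ha
    have h1 := horth a ha
    rw [integral_massShellMeasure] at h1
    simp only [massShellRestriction_translate] at h1
    rw [← h1]
    congr 2
    ext p
    simp only [hkdef, Prod.smul_fst, Prod.smul_snd, smul_eq_mul]
    ring
  have hk0 : k =ᵐ[volume] 0 := by
    rcases hs1 with rfl | rfl
    · refine ae_eq_zero_of_re_integral_forwardCone_eq_zero hm hk hkw fun a ha => ?_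
      simpa only [one_mul] using hzero a ha
    · have hk' : Integrable fun p => (starRingEnd ℂ) (k p) :=
        (conjCLE : ℂ →L[ℝ] ℂ).integrable_comp hk
      have hkw' : Integrable fun p => (starRingEnd ℂ) (k p) * (Real.sqrt (m ^ 2 + p ^ 2) : ℝ) := by
        refine ((conjCLE : ℂ →L[ℝ] ℂ).integrable_comp hkw).congr (Eventually.of_forall fun p => ?_)
        simp
      have := ae_eq_zero_of_re_integral_forwardCone_eq_zero hm hk' hkw' fun a ha => ?_
      · filter_upwards [this] with p hp
        simpa using hp
      · rw [← hzero a ha, ← conj_re, ← integral_conj]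
        congr 2
        ext p
        rw [map_mul, conj_conj, ← exp_conj]
        congr 2
        simp
        ring
  filter_upwards [hk0] with p hp
  refine (mul_eq_zero.1 hp).resolve_left ?_
  have := sqrt_massShell_pos hm p
  exact_mod_cast (by positivity : (1 / (2 * Real.sqrt (m ^ 2 + p ^ 2)) : ℝ) ≠ 0)

/-- Small nonnegative bump functions supported near the vertex of a light cone. -/
theorem exists_testFunction_near_vertex {s : ℝ} (hs1 : s = 1 ∨ s = -1) {δ : ℝ} (hδ : 0 < δ) :
    ∃ f : ℝ × ℝ → ℝ, ContDiff ℝ (⊤ : ℕ∞) f ∧ HasCompactSupport f ∧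
      tsupport f ⊆ {a | s • a ∈ forwardCone ∧ |a.1| ≤ 4 * δ ∧ |a.2| ≤ δ} ∧
      (∀ a, 0 ≤ f a) ∧ f ≠ 0 := by
  let φ : ContDiffBump ((s * (3 * δ), 0) : ℝ × ℝ) := ⟨δ / 2, δ, by linarith, by linarith⟩
  refine ⟨φ, φ.contDiff, φ.hasCompactSupport, ?_, fun a => φ.nonneg, fun h => ?_⟩
  · rw [φ.tsupport_eq]
    intro a ha
    rw [Metric.mem_closedBall, Prod.dist_eq, max_le_iff, Real.dist_eq, Real.dist_eq, sub_zero,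
      abs_le] at ha
    obtain ⟨⟨h1, h2⟩, h3⟩ := ha
    change -δ ≤ _ at h1
    change _ ≤ δ at h2
    change _ ≤ δ at h3
    simp only [forwardCone, Set.mem_ofPred_eq, Prod.smul_fst, Prod.smul_snd, smul_eq_mul, abs_mul]
    refine ⟨?_, abs_le.2 ?_, h3⟩
    · rcases hs1 with rfl | rfl <;> simp at * <;> linarith
    · rcases hs1 with rfl | rfl <;> constructor <;> linarith
  · have h1 : φ (s * (3 * δ), 0) = 1 := φ.one_of_mem_closedBall (Metric.mem_closedBall_self φ.rIn_pos.le)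
    rw [h] at h1
    simp at h1

theorem topologicalClosure_span_localOneParticleVectors {m : ℝ} (hm : 0 < m) {s : ℝ}
    (hs1 : s = 1 ∨ s = -1) {V : Set (ℝ × ℝ)} (hV : ∀ a, a ∈ V ↔ s • a ∈ forwardCone) :
    (Submodule.span ℝ (localOneParticleVectors m V)).topologicalClosure = ⊤ := by
  rw [Submodule.topologicalClosure_eq_top_iff, Submodule.eq_bot_iff]
  intro h hh
  have hss : s * s = 1 := by rcases hs1 with rfl | rfl <;> norm_num
  have horth : ∀ f : ℝ × ℝ → ℝ, ContDiff ℝ (⊤ : ℕ∞) f → HasCompactSupport f → tsupport f ⊆ V →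
      (∫ p, (starRingEnd ℂ) (h p) * massShellRestriction m f p ∂massShellMeasure m).re = 0 := by
    intro f hf hs hfV
    have hF := memLp_massShellRestriction hm hf hs
    have hconj : MemLp (fun p => (starRingEnd ℂ) (h p)) 2 (massShellMeasure m) :=
      (Lp.memLp h).star
    have h1 := (Submodule.mem_orthogonal _ _).1 hh hF.toLp
      (Submodule.subset_span ⟨f, hf, hs, hfV, hF.coeFn_toLp⟩)
    rw [L2.inner_def] at h1
    have h2 := reCLM.integral_comp_comm (hconj.integrable_mul hF)
    simp only [reCLM_apply, Pi.mul_apply] at h2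
    rw [← h2, ← h1]
    refine integral_congr_ae ?_
    filter_upwards [hF.coeFn_toLp] with p hp
    rw [hp, Complex.inner, ← conj_re, map_mul, conj_conj]
  have hae : ∀ n : ℕ, ∃ f : ℝ × ℝ → ℝ, Continuous f ∧ HasCompactSupport f ∧ (∀ a, 0 ≤ f a) ∧
      f ≠ 0 ∧ (∀ a, f a ≠ 0 → |a.1| ≤ 4 * (1 / ((n : ℝ) + 1)) ∧ |a.2| ≤ 1 / ((n : ℝ) + 1)) ∧
      ∀ᵐ p, (starRingEnd ℂ) (h p) * massShellRestriction m f p = 0 := by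
    intro n
    obtain ⟨f, hf, hs, hfV, hf0, hne⟩ :=
      exists_testFunction_near_vertex hs1 (δ := 1 / ((n : ℝ) + 1)) (by positivity)
    refine ⟨f, hf.continuous, hs, hf0, hne,
      fun a ha => (hfV (subset_tsupport f (Function.mem_support.2 ha))).2, ?_⟩
    refine conj_mul_massShellRestriction_ae_eq_zero hm h hf hs hs1 fun a ha => ?_
    refine horth _ (hf.comp (contDiff_id.sub contDiff_const))
      (hs.comp_homeomorph (Homeomorph.subRight (s • a))) fun x hx => ?_
    have hx' : x - s • a ∈ tsupport f :=
      tsupport_comp_subset_preimage f (f := fun x => x - s • a) (by fun_prop) hx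
    have h1 := (hfV hx').1
    rw [hV]
    simp only [forwardCone, Set.mem_ofPred_eq, Prod.smul_fst, Prod.smul_snd, smul_eq_mul, Prod.fst_sub,
      Prod.snd_sub, mul_sub, ← mul_assoc, hss, one_mul] at h1 ha ⊢
    rw [abs_lt] at h1 ha ⊢
    constructor <;> linarith
  choose f hf hs hf0 hne hsm hz using hae
  have hz' := ae_all_iff.2 hz
  have h0 : ∀ᵐ p, h p = 0 := by
    filter_upwards [hz'] with p hp
    have hw := sqrt_massShell_pos hm p
    obtain ⟨n, hn⟩ := exists_nat_gt (5 * Real.sqrt (m ^ 2 + p ^ 2))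
    have hne' := massShellRestriction_ne_zero m (hf n) (hs n) (hf0 n) (hne n) p fun a ha => by
      obtain ⟨h1, h2⟩ := hsm n a ha
      have h3 := (abs_lt_sqrt_massShell hm p).le
      calc |a.1 * Real.sqrt (m ^ 2 + p ^ 2) - a.2 * p|
          ≤ |a.1 * Real.sqrt (m ^ 2 + p ^ 2)| + |a.2 * p| := abs_sub _ _
        _ = |a.1| * Real.sqrt (m ^ 2 + p ^ 2) + |a.2| * |p| := by
          rw [abs_mul, abs_mul, abs_of_pos hw]
        _ ≤ 4 * (1 / ((n : ℝ) + 1)) * Real.sqrt (m ^ 2 + p ^ 2) +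
            1 / ((n : ℝ) + 1) * Real.sqrt (m ^ 2 + p ^ 2) := by gcongr
        _ = 5 * Real.sqrt (m ^ 2 + p ^ 2) / ((n : ℝ) + 1) := by ring
        _ ≤ 1 := by rw [div_le_one (by positivity)]; linarith
    have := (mul_eq_zero.1 (hp n)).resolve_right hne'
    simpa using this
  rw [Lp.eq_zero_iff_ae_eq_zero]
  exact (withDensity_absolutelyContinuous _ _).ae_le h0

end

/-- For every `m > 0`, the closed real-linear span in `ℋ_m` of the mass-shell restrictions of
test functions supported in the backward light cone `V₋` is all of `ℋ_m`; the same holds with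
`V₋` replaced by the forward light cone `V₊`. -/
theorem localOneParticleVectors_dense (m : ℝ) (hm : 0 < m) :
    (Submodule.span ℝ (localOneParticleVectors m backwardCone)).topologicalClosure = ⊤ ∧
    (Submodule.span ℝ (localOneParticleVectors m forwardCone)).topologicalClosure = ⊤ := by
  refine ⟨topologicalClosure_span_localOneParticleVectors hm (Or.inr rfl) fun a => ?_,
    topologicalClosure_span_localOneParticleVectors hm (Or.inl rfl) fun a => by simp⟩
  simp [backwardCone, forwardCone, lt_neg]
end

section
/- For all t, s ∈ ℝ with e^{t+s} + 1 − e^{t} > 0, setting s' = ln(e^{t+s} + 1 − e^{t}) and t' = ln(e^{t+s}/(e^{t+s} + 1 − e^{t})), one has: for every a ∈ ℝ such that e^{−s} a + 1 − a ≠ 0, it holds that e^{−t} · φ_s(a) = φ_{s'}(e^{−t'} a); that is, δ_t ∘ φ_s = φ_{s'} ∘ δ_{t'} wherever both sides are defined. -/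
/-- The Möbius dilation `Λ_{(0,1)}(s)` fixing `0` and `1`, on the real line:
`φ_s(a) = e^{-s} a / (e^{-s} a + 1 - a)`. -/
noncomputable def mobiusDilation01 (s a : ℝ) : ℝ :=
  Real.exp (-s) * a / (Real.exp (-s) * a + 1 - a)

/-- The commutation relation `δ_t ∘ Λ_{(0,1)}(s) = Λ_{(0,1)}(s') ∘ δ_{t'}` with
`s' = ln(e^{t+s}+1-e^t)` and `t' = ln(e^{t+s}/(e^{t+s}+1-e^t))`, wherever defined. -/
theorem dilation_mobius_commutation (t s : ℝ) (h : Real.exp (t + s) + 1 - Real.exp t > 0) :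
    ∀ a : ℝ, Real.exp (-s) * a + 1 - a ≠ 0 →
      Real.exp (-t) * mobiusDilation01 s a =
        mobiusDilation01 (Real.log (Real.exp (t + s) + 1 - Real.exp t))
          (Real.exp (-(Real.log (Real.exp (t + s) / (Real.exp (t + s) + 1 - Real.exp t)))) * a) := by
  intro a _
  have hnum : Real.exp (-Real.log (Real.exp (t + s) + 1 - Real.exp t)) *
        (Real.exp (-(Real.log (Real.exp (t + s) / (Real.exp (t + s) + 1 - Real.exp t)))) * a) =
      Real.exp (-t) * (Real.exp (-s) * a) := by
    rw [Real.exp_neg, Real.exp_neg, Real.exp_log h, Real.exp_log (div_pos (Real.exp_pos _) h),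
      ← mul_assoc (Real.exp (-t)), ← Real.exp_add, ← neg_add, Real.exp_neg]
    field_simp
  have hscale : Real.exp (-(Real.log (Real.exp (t + s) / (Real.exp (t + s) + 1 - Real.exp t)))) =
      1 + Real.exp (-t) * Real.exp (-s) - Real.exp (-s) := by
    rw [Real.exp_neg, Real.exp_log (div_pos (Real.exp_pos _) h), inv_div, Real.exp_neg,
      Real.exp_neg, Real.exp_add]
    field_simp
  unfold mobiusDilation01
  rw [hnum, hscale, ← mul_div_assoc]
  congr 1
  ring
end

section
/- Let f ∈ L¹(ℝ; ℂ) and c ∈ ℝ be such that f = 0 almost everywhere on (−∞, c). If the Fourier transform of f vanishes on some nonempty open interval (α, β) ⊂ ℝ, then f = 0 almost everywhere. -/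
open MeasureTheory

open Complex Set Filter Topology FourierTransform

/-- A function that is holomorphic in the lower half-plane, continuous up to the real line, and zero
on the upper side of a square hanging from the real line vanishes at the centre of the square. -/
lemma DiffContOnCl.eq_zero_of_square_below_interval {F : ℂ → ℂ}
    (hF : DiffContOnCl ℂ F {z | z.im < 0}) {x d : ℝ} (hd : 0 < d)
    (h0 : ∀ t ∈ Icc (x - d) (x + d), F (t : ℂ) = 0) : F (x - d * I) = 0 := by
  set w : ℂ := x - d * I with hw
  have hwre : w.re = x := by simp [hw]
  have hwim : w.im = -d := by simp [hw]
  set S : Set ℂ := Ioo (-d) d ×ℂ Ioo (-d) d with hS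
  have factor (u : ℂ) (hu : ∀ z ∈ S, (u * z).im < d) :
      DiffContOnCl ℂ (fun z ↦ F (w + u * z)) S := by
    refine hF.comp (g := fun z ↦ w + u * z) (Differentiable.diffContOnCl (by fun_prop)) ?_
    intro z hz
    have := hu z hz
    simp only [mem_ofPred_eq, add_im, hwim]
    linarith
  have top (z : ℂ) (him : z.im = d) (hre : z.re ∈ Icc (-d) d) : F (w + z) = 0 := by
    have : w + z = ((x + z.re : ℝ) : ℂ) := by
      apply Complex.ext <;> simp [hwre, hwim, him]
    rw [this]
    exact h0 _ ⟨by linarith [hre.1], by linarith [hre.2]⟩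
  let P : ℂ → ℂ := fun z ↦
    (F (w + 1 * z) * F (w + I * z)) * (F (w + -1 * z) * F (w + -I * z))
  have hP : DiffContOnCl ℂ P S := by
    have mul {f g : ℂ → ℂ} (hf : DiffContOnCl ℂ f S) (hg : DiffContOnCl ℂ g S) :
        DiffContOnCl ℂ (fun z ↦ f z * g z) S := hf.smul hg
    refine mul (mul (factor 1 ?_) (factor I ?_)) (mul (factor (-1) ?_) (factor (-I) ?_)) <;>
    · rintro z ⟨⟨h1, h2⟩, h3, h4⟩
      simp
      linarith
  have hcl : closure (Ioo (-d) d) = Icc (-d) d := closure_Ioo (by linarith)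
  have hfr : frontier (Ioo (-d) d) = {-d, d} := frontier_Ioo (by linarith)
  have hbd : EqOn P (fun _ ↦ 0) (frontier S) := by
    intro z hz
    rw [hS, frontier_reProdIm, hcl, hfr] at hz
    rcases hz with ⟨hre, him⟩ | ⟨hre, him⟩
    · rcases him with him | him
      · have := top (-1 * z) (by simpa using neg_eq_iff_eq_neg.2 him)
          ⟨by simpa using hre.2, by simpa using neg_le.1 hre.1⟩
        simp only [P, this, zero_mul, mul_zero]
      · have := top (1 * z) (by simpa using him) (by simpa using hre)
        simp only [P, this, zero_mul]
    · rcases hre with hre | hre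
      · have := top (-I * z) (by simpa using neg_eq_iff_eq_neg.2 hre)
          (by simpa using him)
        simp only [P, this, mul_zero]
      · have := top (I * z) (by simpa using hre)
          ⟨by simpa using him.2, by simpa using neg_le.1 him.1⟩
        simp only [P, this, zero_mul, mul_zero]
  have hb : Bornology.IsBounded S := (Metric.isBounded_Ioo _ _).reProdIm (Metric.isBounded_Ioo _ _)
  have h := eqOn_of_eqOn_frontier hb hP diffContOnCl_const hbd
    (show (0 : ℂ) ∈ S from ⟨⟨by simpa, by simpa⟩, by simpa, by simpa⟩)
  simpa [P] using h

/-- Boundary uniqueness: a function holomorphic in the lower half-plane and continuous up to the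
real line that vanishes on a nonempty open interval of the real line is identically zero. -/
lemma DiffContOnCl.eq_zero_of_eq_zero_on_real_interval {F : ℂ → ℂ}
    (hF : DiffContOnCl ℂ F {z | z.im < 0}) {α β : ℝ} (hαβ : α < β)
    (h0 : ∀ t ∈ Ioo α β, F (t : ℂ) = 0) {z : ℂ} (hz : z.im ≤ 0) : F z = 0 := by
  have hopen : IsOpen {z : ℂ | z.im < 0} := isOpen_lt continuous_im continuous_const
  have han : AnalyticOnNhd ℂ F {z | z.im < 0} := hF.differentiableOn.analyticOnNhd hopen
  have key (z : ℂ) (hz : z.im < 0) (h1 : α < z.re + z.im) (h2 : z.re - z.im < β) : F z = 0 := by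
    have := hF.eq_zero_of_square_below_interval (x := z.re) (d := -z.im) (by linarith)
      fun t ht ↦ h0 t ⟨by linarith [ht.1], by linarith [ht.2]⟩
    convert this using 2
    apply Complex.ext <;> simp
  have hzero : EqOn F 0 {z | z.im < 0} := by
    let z₀ : ℂ := ⟨(α + β) / 2, -(β - α) / 4⟩
    refine han.eqOn_zero_of_preconnected_of_eventuallyEq_zero (z₀ := z₀)
      (convex_halfSpace_im_lt 0).isPreconnected ?_ ?_
    · simp only [z₀, mem_ofPred_eq]
      linarith
    · have e1 : ∀ᶠ z : ℂ in 𝓝 z₀, z.im < 0 :=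
        continuous_im.continuousAt.eventually_lt continuousAt_const
          (by simp only [z₀]; linarith)
      have e2 : ∀ᶠ z : ℂ in 𝓝 z₀, α < z.re + z.im :=
        continuousAt_const.eventually_lt (continuous_re.add continuous_im).continuousAt
          (by simp only [z₀]; linarith)
      have e3 : ∀ᶠ z : ℂ in 𝓝 z₀, z.re - z.im < β :=
        (continuous_re.sub continuous_im).continuousAt.eventually_lt continuousAt_const
          (by simp only [z₀, Pi.sub_apply]; linarith)
      filter_upwards [e1, e2, e3] with z using key z
  exact (hzero.of_subset_closure (t := closure {z : ℂ | z.im < 0}) hF.continuousOn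
    continuousOn_const subset_closure subset_rfl) (by rwa [closure_setOfPred_im_lt])

/-- The Fourier–Laplace transform of an integrable function supported in `[c, ∞)` is holomorphic in
the lower half-plane and continuous up to the boundary. -/
lemma diffContOnCl_integral_mul_cexp {f : ℝ → ℂ} (hf : Integrable f) {c : ℝ}
    (hsupp : ∀ᵐ x : ℝ, x < c → f x = 0) :
    DiffContOnCl ℂ (fun z : ℂ ↦ ∫ x : ℝ, f x * cexp (-I * z * (x - c))) {z | z.im < 0} := by
  have norm_exp (z : ℂ) (x : ℝ) : ‖cexp (-I * z * (x - c))‖ = Real.exp (z.im * (x - c)) := by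
    rw [Complex.norm_exp]
    simp
  have meas (z : ℂ) : AEStronglyMeasurable (fun x : ℝ ↦ f x * cexp (-I * z * (x - c))) :=
    hf.1.mul (Continuous.aestronglyMeasurable (by fun_prop))
  have bound : ∀ z ∈ {z : ℂ | z.im ≤ 0}, ∀ᵐ x : ℝ,
      ‖f x * cexp (-I * z * (x - c))‖ ≤ ‖f x‖ := by
    intro z hz
    filter_upwards [hsupp] with x hx
    rcases lt_or_ge x c with h | h
    · simp [hx h]
    · rw [norm_mul, norm_exp]
      refine mul_le_of_le_one_right (norm_nonneg _) (Real.exp_le_one_iff.2 ?_)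
      exact mul_nonpos_of_nonpos_of_nonneg hz (sub_nonneg.2 h)
  constructor
  · intro z₀ hz₀
    rw [mem_ofPred_eq] at hz₀
    set ε : ℝ := -z₀.im / 2 with hε
    have hεpos : 0 < ε := by linarith
    have hs : {z : ℂ | z.im < -ε} ∈ 𝓝 z₀ :=
      (isOpen_lt continuous_im continuous_const).mem_nhds
        (by simp only [mem_ofPred_eq]; linarith)
    refine (hasDerivAt_integral_of_dominated_loc_of_deriv_le (bound := fun x ↦ ‖f x‖ * ε⁻¹)
      (F' := fun z (x : ℝ) ↦ f x * (cexp (-I * z * (x - c)) * (-I * (x - c)))) hs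
      (Eventually.of_forall meas) (hf.norm.mono' (meas z₀) (bound z₀ hz₀.le))
      (hf.1.mul (Continuous.aestronglyMeasurable (by fun_prop))) ?_ (hf.norm.mul_const _)
      ?_).2.differentiableAt.differentiableWithinAt
    · filter_upwards [hsupp] with x hx z (hz : z.im < -ε)
      rcases lt_or_ge x c with h | h
      · simp [hx h]
      · have hxc : 0 ≤ x - c := sub_nonneg.2 h
        have hn : ‖-I * ((x : ℂ) - c)‖ = x - c := by
          rw [norm_mul, norm_neg, norm_I, one_mul, ← ofReal_sub, norm_real,
            Real.norm_of_nonneg hxc]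
        rw [norm_mul, norm_mul, norm_exp, hn]
        refine mul_le_mul_of_nonneg_left ?_ (norm_nonneg _)
        have h1 : ε * (x - c) ≤ Real.exp (ε * (x - c)) :=
          (le_add_of_nonneg_right zero_le_one).trans (Real.add_one_le_exp _)
        have h2 : Real.exp (z.im * (x - c)) ≤ Real.exp (-(ε * (x - c))) :=
          Real.exp_le_exp.2 (by nlinarith)
        calc Real.exp (z.im * (x - c)) * (x - c)
            ≤ Real.exp (-(ε * (x - c))) * (Real.exp (ε * (x - c)) * ε⁻¹) := by
              refine mul_le_mul h2 ?_ hxc (Real.exp_pos _).le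
              rw [le_mul_inv_iff₀ hεpos, mul_comm]
              exact h1
          _ = ε⁻¹ := by rw [← mul_assoc, ← Real.exp_add]; simp
    · refine Eventually.of_forall fun x z _ ↦ ?_
      have h1 : HasDerivAt (fun z : ℂ ↦ -I * z * (x - c)) (-I * (x - c)) z := by
        simpa using ((hasDerivAt_id z).const_mul (-I)).mul_const ((x : ℂ) - c)
      exact h1.cexp.const_mul (f x)
  · rw [closure_setOfPred_im_lt]
    refine continuousOn_of_dominated (fun z _ ↦ meas z) bound hf.norm
      (Eventually.of_forall fun x ↦ Continuous.continuousOn (by fun_prop))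

/-- The Fourier transform is injective on integrable functions. -/
lemma MeasureTheory.Integrable.ae_eq_zero_of_fourier_eq_zero {f : ℝ → ℂ} (hf : Integrable f)
    (h : ∀ ξ, 𝓕 f ξ = 0) : ∀ᵐ x, f x = 0 := by
  refine ae_eq_zero_of_integral_contDiff_smul_eq_zero hf.locallyIntegrable fun g hg hgc ↦ ?_
  let G : SchwartzMap ℝ ℂ := HasCompactSupport.toSchwartzMap (f := fun x ↦ (g x : ℂ))
    (hgc.comp_left ofReal_zero) (ofRealCLM.contDiff.comp hg)
  have hG : 𝓕 (𝓕⁻ G) = G := FourierTransform.fourier_fourierInv_eq G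
  have key := VectorFourier.integral_fourierIntegral_smul_eq_flip (L := innerₗ ℝ)
    Real.continuous_fourierChar continuous_inner hf (𝓕⁻ G).integrable (μ := volume) (ν := volume)
  have hflip : (innerₗ ℝ).flip = innerₗ ℝ := flip_innerₗ ℝ
  rw [hflip] at key
  have hl : ∀ ξ, VectorFourier.fourierIntegral Real.fourierChar volume (innerₗ ℝ) f ξ = 0 := h
  have hr : ∀ x, VectorFourier.fourierIntegral Real.fourierChar volume (innerₗ ℝ)
      (𝓕⁻ G : SchwartzMap ℝ ℂ) x = (g x : ℂ) :=
    fun x ↦ congrArg (fun φ : SchwartzMap ℝ ℂ ↦ φ x) hG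
  simp only [hl, hr, zero_smul, integral_zero] at key
  rw [key]
  congr 1 with x
  simp [mul_comm]

/-- If `f ∈ L¹(ℝ; ℂ)` vanishes a.e. on a half-line `(−∞, c)` and its Fourier transform
vanishes on some nonempty open interval `(α, β)`, then `f = 0` almost everywhere. -/
theorem eq_zero_of_support_halfLine_of_fourier_vanishes_on_interval
    (f : ℝ → ℂ) (hf : Integrable f) (c : ℝ)
    (hsupp : ∀ᵐ x : ℝ, x < c → f x = 0)
    (α β : ℝ) (hαβ : α < β)
    (hF : ∀ ξ ∈ Set.Ioo α β, ∫ x : ℝ, f x * Complex.exp (-Complex.I * ξ * x) = 0) :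
    ∀ᵐ x : ℝ, f x = 0 := by
  have hshift (ξ : ℂ) : ∫ x : ℝ, f x * cexp (-I * ξ * (x - c)) =
      (∫ x : ℝ, f x * cexp (-I * ξ * x)) * cexp (I * ξ * c) := by
    rw [← integral_mul_const]
    congr 1 with x
    rw [mul_assoc (f x), ← Complex.exp_add]
    ring_nf
  have hzero (ξ : ℝ) : ∫ x : ℝ, f x * cexp (-I * ξ * x) = 0 := by
    have := (diffContOnCl_integral_mul_cexp hf hsupp).eq_zero_of_eq_zero_on_real_interval hαβ
      (fun t ht ↦ by rw [hshift, hF t ht, zero_mul]) (z := ξ) (by simp)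
    rw [hshift] at this
    exact (mul_eq_zero.1 this).resolve_right (Complex.exp_ne_zero _)
  refine hf.ae_eq_zero_of_fourier_eq_zero fun ξ ↦ ?_
  rw [Real.fourier_real_eq_integral_exp_smul, ← hzero (2 * Real.pi * ξ)]
  congr 1 with x
  rw [smul_eq_mul, mul_comm]
  push_cast
  ring_nf
end

section
/- For every m > 0 and λ ∈ ℝ, the map β_λ preserves the measure μ_m on ℝ with density 1/(2ω_m(p)) with respect to Lebesgue measure; that is, the pushforward of μ_m under β_λ equals μ_m. Consequently, ξ ↦ ξ ∘ β_{−λ} defines a unitary operator on L²(ℝ, μ_m). -/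
open MeasureTheory

/-- The Lorentz boost on the mass-`m` shell, in momentum coordinates:
`β_λ(p) = cosh λ · p − sinh λ · ω_m(p)` where `ω_m(p) = √(m² + p²)`. -/
noncomputable def massShellBoost (m lam p : ℝ) : ℝ :=
  Real.cosh lam * p - Real.sinh lam * Real.sqrt (m ^ 2 + p ^ 2)

theorem abs_lt_sqrt_sq_add_sq {m : ℝ} (hm : 0 < m) (p : ℝ) : |p| < √(m ^ 2 + p ^ 2) :=
  Real.lt_sqrt_of_sq_lt (by rw [sq_abs]; linarith [pow_pos hm 2])

/-- The energy transforms under a boost like the time component of a Lorentz vector. -/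
theorem sqrt_sq_add_massShellBoost_sq {m : ℝ} (hm : 0 < m) (lam p : ℝ) :
    √(m ^ 2 + massShellBoost m lam p ^ 2) =
      Real.cosh lam * √(m ^ 2 + p ^ 2) - Real.sinh lam * p := by
  have hw : √(m ^ 2 + p ^ 2) ^ 2 = m ^ 2 + p ^ 2 := Real.sq_sqrt (by positivity)
  have hp := abs_lt_sqrt_sq_add_sq hm p
  have hc : |Real.sinh lam| ≤ Real.cosh lam := by
    refine abs_le_of_sq_le_sq ?_ (Real.cosh_pos lam).le
    linarith [Real.cosh_sq lam]
  have hs : Real.sinh lam * p ≤ Real.cosh lam * √(m ^ 2 + p ^ 2) :=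
    calc Real.sinh lam * p ≤ |Real.sinh lam| * |p| := by rw [← abs_mul]; exact le_abs_self _
      _ ≤ _ := by gcongr
  rw [Real.sqrt_eq_iff_eq_sq (by positivity) (sub_nonneg.2 hs), massShellBoost]
  linear_combination (Real.sinh lam ^ 2 - Real.cosh lam ^ 2) * hw - m ^ 2 * Real.cosh_sq lam

theorem massShellBoost_neg_massShellBoost {m : ℝ} (hm : 0 < m) (lam p : ℝ) :
    massShellBoost m (-lam) (massShellBoost m lam p) = p := by
  rw [massShellBoost, sqrt_sq_add_massShellBoost_sq hm, massShellBoost, Real.cosh_neg,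
    Real.sinh_neg]
  linear_combination p * Real.cosh_sq lam

theorem massShellBoost_massShellBoost_neg {m : ℝ} (hm : 0 < m) (lam p : ℝ) :
    massShellBoost m lam (massShellBoost m (-lam) p) = p := by
  simpa using massShellBoost_neg_massShellBoost hm (-lam) p

theorem measurable_massShellBoost (m lam : ℝ) : Measurable (massShellBoost m lam) := by
  unfold massShellBoost
  fun_prop

theorem hasDerivAt_massShellBoost {m : ℝ} (hm : 0 < m) (lam p : ℝ) :
    HasDerivAt (massShellBoost m lam)
      (√(m ^ 2 + massShellBoost m lam p ^ 2) / √(m ^ 2 + p ^ 2)) p := by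
  have hpos : 0 < m ^ 2 + p ^ 2 := by positivity
  have hw : √(m ^ 2 + p ^ 2) ≠ 0 := (Real.sqrt_pos.2 hpos).ne'
  have h := ((hasDerivAt_id p).const_mul (Real.cosh lam)).sub
    (((((hasDerivAt_id p).pow 2).const_add (m ^ 2)).sqrt hpos.ne').const_mul (Real.sinh lam))
  refine h.congr_deriv ?_
  rw [sqrt_sq_add_massShellBoost_sq hm]
  simp
  field_simp

theorem measurePreserving_massShellBoost {m : ℝ} (hm : 0 < m) (lam : ℝ) :
    MeasurePreserving (massShellBoost m lam) (massShellMeasure m) (massShellMeasure m) := by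
  refine ⟨measurable_massShellBoost m lam, ?_⟩
  ext t ht
  have hpre := measurable_massShellBoost m lam ht
  have hsurj : Function.Surjective (massShellBoost m lam) :=
    Function.RightInverse.surjective (massShellBoost_massShellBoost_neg hm lam)
  have hinj : Function.Injective (massShellBoost m lam) :=
    Function.LeftInverse.injective (massShellBoost_neg_massShellBoost hm lam)
  rw [Measure.map_apply (measurable_massShellBoost m lam) ht, massShellMeasure,
    withDensity_apply _ hpre, withDensity_apply _ ht]
  conv_rhs => rw [← Set.image_preimage_eq t hsurj]
  rw [lintegral_image_eq_lintegral_abs_deriv_mul hpre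
    (fun p _ => (hasDerivAt_massShellBoost hm lam p).hasDerivWithinAt) hinj.injOn]
  refine lintegral_congr fun p => ?_
  have hb : 0 < √(m ^ 2 + massShellBoost m lam p ^ 2) := Real.sqrt_pos.2 (by positivity)
  rw [← ENNReal.ofReal_mul (abs_nonneg _), abs_of_nonneg (by positivity)]
  congr 1
  field_simp

/-- For every `m > 0` and `λ ∈ ℝ`, the boost `β_λ` preserves the measure `μ_m`, and
consequently `ξ ↦ ξ ∘ β_{−λ}` defines a unitary operator on `L²(ℝ, μ_m)`. -/
theorem massShellBoost_measurePreserving (m lam : ℝ) (hm : 0 < m) :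
    MeasurePreserving (massShellBoost m lam) (massShellMeasure m) (massShellMeasure m) ∧
    ∃ U : Lp ℂ 2 (massShellMeasure m) ≃ₗᵢ[ℂ] Lp ℂ 2 (massShellMeasure m),
      ∀ ξ : Lp ℂ 2 (massShellMeasure m),
        (U ξ : ℝ → ℂ) =ᵐ[massShellMeasure m]
          fun p => (ξ : ℝ → ℂ) (massShellBoost m (-lam) p) := by
  have hinv := measurePreserving_massShellBoost hm (-lam)
  have hfwd := measurePreserving_massShellBoost hm lam
  refine ⟨hfwd, LinearIsometryEquiv.ofSurjective (Lp.compMeasurePreservingₗᵢ ℂ _ hinv) fun ξ =>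
    ⟨Lp.compMeasurePreserving _ hfwd ξ, ?_⟩, fun ξ => Lp.coeFn_compMeasurePreserving ξ hinv⟩
  change Lp.compMeasurePreserving _ hinv (Lp.compMeasurePreserving _ hfwd ξ) = ξ
  rw [← Lp.compMeasurePreserving_comp_apply]
  have hid : massShellBoost m lam ∘ massShellBoost m (-lam) = id :=
    funext (massShellBoost_massShellBoost_neg hm lam)
  simp only [hid, Lp.compMeasurePreserving_id_apply]
end
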